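/- (Error estimate without spillback.) Let f be a fundamental diagram on the link [a,b], T > 0, η ∈ (0,1), Δ > 0, and S̄ > 0 a constant (the effective supply min{C₁,C₃} of the uncongested downstream link). Let N_ini : [a,b] → ℝ and N_up : [0,T] → ℝ be fixed lower semicontinuous functions, let 𝒞^Δ be the value condition equal to N_ini on {0}×[a,b], to N_up on [0,T]×{a}, to N_down^Δ(s) = S̄ ∫₀ˢ u_Δ(τ) dτ on [0,T]×{b}, and +∞ elsewhere, and let 𝒞⁰ be the same value condition with downstream part N_down⁰(s) = η S̄ s. Then for all (t,x) ∈ [0,T]×[a,b], |N_{𝒞^Δ}(t,x) − N_{𝒞⁰}(t,x)| ≤ η(1−η) Δ S̄ ≤ Δ S̄ / 4. -/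

import Mathlib

open Set

/-- The Δ-periodic on-and-off traffic signal with split η: equal to 1 (green)
during the first ηΔ of each cycle of length Δ, and 0 (red) otherwise. -/
noncomputable def uOnOff (Δ η τ : ℝ) : ℝ :=
  if τ - Δ * (⌊τ / Δ⌋ : ℝ) < η * Δ then 1 else 0

/-- The concave conjugate `f*(u) = sup_{ρ ∈ [0,ρ_j]} (f(ρ) − uρ)` of a fundamental
diagram `f` with jam density `ρ_j`. -/
noncomputable def concConj (f : ℝ → ℝ) (ρj u : ℝ) : ℝ :=
  sSup ((fun ρ => f ρ - u * ρ) '' Set.Icc 0 ρj)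

/-- The generalized Lax-Hopf viability episolution on `[0,T] × [a,b]` associated with a
value condition `𝒞 : [0,T]×[a,b] → ℝ ∪ {+∞}` (encoded as an `EReal`-valued function). -/
noncomputable def laxHopf (fs : ℝ → ℝ) (v w T a b : ℝ) (𝒞 : ℝ → ℝ → EReal)
    (t x : ℝ) : EReal :=
  sInf { z : EReal | ∃ u τ : ℝ, u ∈ Set.Icc (-w) v ∧ 0 ≤ τ ∧
    (t - τ) ∈ Set.Icc 0 T ∧ (x - τ * u) ∈ Set.Icc a b ∧
    z = 𝒞 (t - τ) (x - τ * u) + ((τ * fs u : ℝ) : EReal) }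

/-- The value condition equal to `N_ini(y)` at points `(0,y)`, to `N_up(s)` at points `(s,a)`,
to `N_down(s)` at points `(s,b)`, and `+∞` elsewhere. -/
noncomputable def cornerVC (Nini Nup Ndown : ℝ → ℝ) (a b : ℝ) (s y : ℝ) : EReal :=
  if s = 0 then (Nini y : EReal)
  else if y = a then (Nup s : EReal)
  else if y = b then (Ndown s : EReal)
  else (⊤ : EReal)

theorem uOnOff_periodic {Δ : ℝ} (hΔ : 0 < Δ) (η : ℝ) : Function.Periodic (uOnOff Δ η) Δ := by
  intro τ
  have h : (τ + Δ) / Δ = τ / Δ + 1 := by field_simp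
  unfold uOnOff
  rw [h, Int.floor_add_one]
  push_cast
  rw [show τ + Δ - Δ * ((⌊τ / Δ⌋ : ℝ) + 1) = τ - Δ * (⌊τ / Δ⌋ : ℝ) by ring]

theorem measurable_uOnOff (Δ η : ℝ) : Measurable (uOnOff Δ η) := by
  unfold uOnOff
  refine Measurable.ite (measurableSet_lt ?_ measurable_const) measurable_const measurable_const
  fun_prop

theorem intervalIntegrable_uOnOff (Δ η c d : ℝ) :
    IntervalIntegrable (uOnOff Δ η) MeasureTheory.volume c d := by
  rw [intervalIntegrable_iff]
  refine MeasureTheory.Measure.integrableOn_of_bounded (M := 1) (by simp)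
    (measurable_uOnOff Δ η).aestronglyMeasurable (Filter.Eventually.of_forall fun τ => ?_)
  unfold uOnOff
  split_ifs <;> simp

theorem floor_div_eq_zero {Δ τ : ℝ} (hΔ : 0 < Δ) (h0 : 0 ≤ τ) (h1 : τ < Δ) : ⌊τ / Δ⌋ = 0 := by
  rw [Int.floor_eq_zero_iff]
  exact ⟨by positivity, (div_lt_one hΔ).2 h1⟩

/-- Green time elapsed within the first cycle. -/
theorem integral_uOnOff_first_cycle {Δ η r : ℝ} (hΔ : 0 < Δ) (hη : η ∈ Ioo (0 : ℝ) 1)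
    (hr0 : 0 ≤ r) (hr1 : r ≤ Δ) :
    ∫ τ in (0 : ℝ)..r, uOnOff Δ η τ = min r (η * Δ) := by
  obtain ⟨hη0, hη1⟩ := hη
  have hηΔ : 0 < η * Δ := by positivity
  have green : ∀ r, 0 ≤ r → r ≤ Δ → r ≤ η * Δ → ∫ τ in (0 : ℝ)..r, uOnOff Δ η τ = r := by
    intro r hr0 hr1 hr
    rw [intervalIntegral.integral_congr_Ioo_of_le (g := fun _ => (1 : ℝ)) hr0]
    · simp
    · intro τ hτ
      have := floor_div_eq_zero hΔ hτ.1.le (hτ.2.trans_le hr1)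
      simp [uOnOff, this, hτ.2.trans_le hr]
  rcases le_total r (η * Δ) with h | h
  · rw [min_eq_left h, green r hr0 hr1 h]
  · rw [min_eq_right h, ← intervalIntegral.integral_add_adjacent_intervals
      (intervalIntegrable_uOnOff Δ η 0 (η * Δ)) (intervalIntegrable_uOnOff Δ η (η * Δ) r),
      green _ hηΔ.le (by nlinarith) le_rfl,
      intervalIntegral.integral_congr_Ioo_of_le (g := fun _ => (0 : ℝ)) h]
    · simp
    · intro τ hτ
      have := floor_div_eq_zero hΔ (hηΔ.trans hτ.1).le (hτ.2.trans_le hr1)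
      simp [uOnOff, this, hτ.1.le]

theorem integral_uOnOff {Δ η : ℝ} (hΔ : 0 < Δ) (hη : η ∈ Ioo (0 : ℝ) 1) (s : ℝ) :
    ∫ τ in (0 : ℝ)..s, uOnOff Δ η τ =
      ⌊s / Δ⌋ * (η * Δ) + min (s - ⌊s / Δ⌋ * Δ) (η * Δ) := by
  have hp := uOnOff_periodic hΔ η
  set n : ℤ := ⌊s / Δ⌋ with hn
  have h1 : (n : ℝ) * Δ ≤ s := (le_div_iff₀ hΔ).1 (Int.floor_le _)
  have h2 : s < (n + 1 : ℝ) * Δ := (div_lt_iff₀ hΔ).1 (Int.lt_floor_add_one _)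
  have hcycles : ∫ τ in (0 : ℝ)..(n * Δ), uOnOff Δ η τ = n * (η * Δ) := by
    have := hp.intervalIntegral_add_zsmul_eq n 0 (intervalIntegrable_uOnOff Δ η)
    have hmin : min Δ (η * Δ) = η * Δ := min_eq_right (by nlinarith [hη.2])
    rw [zero_add, zero_add, integral_uOnOff_first_cycle hΔ hη hΔ.le le_rfl, hmin] at this
    simpa using this
  have hrest : ∫ τ in (n * Δ)..s, uOnOff Δ η τ = min (s - n * Δ) (η * Δ) := by
    rw [← integral_uOnOff_first_cycle hΔ hη (sub_nonneg.2 h1) (by linarith),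
      ← sub_self (n * Δ : ℝ), ← intervalIntegral.integral_comp_sub_right]
    simp only [hp.sub_int_mul_eq]
  rw [← intervalIntegral.integral_add_adjacent_intervals
    (intervalIntegrable_uOnOff Δ η 0 (n * Δ)) (intervalIntegrable_uOnOff Δ η (n * Δ) s),
    hcycles, hrest]

theorem integral_uOnOff_mem_Icc {Δ η : ℝ} (hΔ : 0 < Δ) (hη : η ∈ Ioo (0 : ℝ) 1) (s : ℝ) :
    ∫ τ in (0 : ℝ)..s, uOnOff Δ η τ ∈ Icc (η * s) (η * s + η * (1 - η) * Δ) := by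
  rw [integral_uOnOff hΔ hη]
  have h1 : (⌊s / Δ⌋ : ℝ) * Δ ≤ s := (le_div_iff₀ hΔ).1 (Int.floor_le _)
  have h2 : s < (⌊s / Δ⌋ + 1 : ℝ) * Δ := (div_lt_iff₀ hΔ).1 (Int.lt_floor_add_one _)
  obtain ⟨hη0, hη1⟩ := hη
  generalize (⌊s / Δ⌋ : ℝ) = n at *
  rcases le_total (s - n * Δ) (η * Δ) with h | h
  · rw [min_eq_left h]
    constructor <;> nlinarith
  · rw [min_eq_right h]
    constructor <;> nlinarith

theorem cornerVC_mono {Ndown Ndown' : ℝ → ℝ} (h : ∀ s, Ndown s ≤ Ndown' s) (Nini Nup : ℝ → ℝ)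
    (a b s y : ℝ) : cornerVC Nini Nup Ndown a b s y ≤ cornerVC Nini Nup Ndown' a b s y := by
  unfold cornerVC
  split_ifs <;> simp [h]

theorem cornerVC_le_add {Ndown Ndown' : ℝ → ℝ} {E : ℝ} (hE : 0 ≤ E)
    (h : ∀ s, Ndown' s ≤ Ndown s + E) (Nini Nup : ℝ → ℝ) (a b s y : ℝ) :
    cornerVC Nini Nup Ndown' a b s y ≤ cornerVC Nini Nup Ndown a b s y + (E : EReal) := by
  unfold cornerVC
  split_ifs
  · exact_mod_cast le_add_of_nonneg_right hE
  · exact_mod_cast le_add_of_nonneg_right hE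
  · exact_mod_cast h s
  · simp

/-- An upper bound of one value condition by another, up to a constant, passes to the
Lax-Hopf episolutions. -/
theorem laxHopf_le_add {𝒞 𝒞' : ℝ → ℝ → EReal} {E : ℝ}
    (h : ∀ s y, 𝒞' s y ≤ 𝒞 s y + (E : EReal)) (fs : ℝ → ℝ) (v w T a b t x : ℝ) :
    laxHopf fs v w T a b 𝒞' t x ≤ laxHopf fs v w T a b 𝒞 t x + (E : EReal) := by
  rw [← EReal.sub_le_iff_le_add (by simp) (by simp)]
  refine le_sInf ?_
  rintro z ⟨u, τ, hu, hτ, ht, hx, rfl⟩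
  rw [EReal.sub_le_iff_le_add (by simp) (by simp)]
  have hle : laxHopf fs v w T a b 𝒞' t x ≤
      𝒞' (t - τ) (x - τ * u) + ((τ * fs u : ℝ) : EReal) :=
    sInf_le ⟨u, τ, hu, hτ, ht, hx, rfl⟩
  refine hle.trans ?_
  rw [add_right_comm]
  exact add_le_add_left (h _ _) _

theorem EReal.abs_toReal_sub_le {x y : EReal} {E : ℝ} (hE : 0 ≤ E) (h1 : y ≤ x)
    (h2 : x ≤ y + (E : EReal)) : |x.toReal - y.toReal| ≤ E := by
  induction y with
  | bot =>
    have : x = ⊥ := by simpa using h2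
    simpa [this] using hE
  | top =>
    have : x = ⊤ := by simpa using h1
    simpa [this] using hE
  | coe y =>
    induction x with
    | bot => simp at h1
    | top => exact absurd h2 (by simp [← EReal.coe_add])
    | coe x =>
      have h1' : y ≤ x := by exact_mod_cast h1
      have h2' : x ≤ y + E := by exact_mod_cast h2
      rw [EReal.toReal_coe, EReal.toReal_coe, abs_le]
      constructor <;> linarith

/-- **Error estimate without spillback.** With a constant effective supply `Sbar`
(no spillback), the solutions of the on-and-off and continuum signal models differ by
at most `η(1−η)ΔSbar ≤ ΔSbar/4`, uniformly in time and space. -/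
theorem laxHopf_onOff_error_no_spillback
    -- the fundamental diagram
    (ρj : ℝ) (hρj : 0 < ρj) (f : ℝ → ℝ)
    (hfc : ContinuousOn f (Set.Icc 0 ρj)) (hconc : ConcaveOn ℝ (Set.Icc 0 ρj) f)
    (hf0 : f 0 = 0) (hfρj : f ρj = 0)
    -- wave speeds: right derivative of f at 0 and minus the left derivative at ρ_j
    (v w : ℝ) (hv : 0 < v) (hw : 0 < w)
    (hv' : HasDerivWithinAt f v (Set.Ici 0) 0)
    (hw' : HasDerivWithinAt f (-w) (Set.Iic ρj) ρj)
    -- the domain, signal cycle and split, and constant effective supply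
    (T a b : ℝ) (hT : 0 < T) (hab : a < b)
    (η Δ : ℝ) (hη : η ∈ Set.Ioo (0:ℝ) 1) (hΔ : 0 < Δ) (Sbar : ℝ) (hSbar : 0 < Sbar)
    -- the (lower semicontinuous) initial and upstream data
    (Nini Nup : ℝ → ℝ)
    (hini : LowerSemicontinuousOn Nini (Set.Icc a b))
    (hup : LowerSemicontinuousOn Nup (Set.Icc 0 T)) :
    ∀ t x, t ∈ Set.Icc 0 T → x ∈ Set.Icc a b →
      |(laxHopf (concConj f ρj) v w T a b
          (cornerVC Nini Nup (fun s => Sbar * ∫ τ in (0:ℝ)..s, uOnOff Δ η τ) a b) t x).toReal -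
        (laxHopf (concConj f ρj) v w T a b
          (cornerVC Nini Nup (fun s => η * Sbar * s) a b) t x).toReal|
        ≤ η * (1 - η) * Δ * Sbar ∧
      η * (1 - η) * Δ * Sbar ≤ Δ * Sbar / 4 := by
  intro t x _ _
  have hE : 0 ≤ η * (1 - η) * Δ * Sbar := by
    have := sub_pos.2 hη.2
    have := hη.1
    positivity
  have hlow : ∀ s, η * Sbar * s ≤ Sbar * ∫ τ in (0 : ℝ)..s, uOnOff Δ η τ := fun s => by
    nlinarith [(integral_uOnOff_mem_Icc hΔ hη s).1]
  have hupp : ∀ s, Sbar * (∫ τ in (0 : ℝ)..s, uOnOff Δ η τ)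
      ≤ η * Sbar * s + η * (1 - η) * Δ * Sbar := fun s => by
    nlinarith [(integral_uOnOff_mem_Icc hΔ hη s).2]
  refine ⟨EReal.abs_toReal_sub_le hE ?_
    (laxHopf_le_add (cornerVC_le_add hE hupp Nini Nup a b) _ v w T a b t x), ?_⟩
  · simpa using laxHopf_le_add (E := 0)
      (fun s y => by simpa using cornerVC_mono hlow Nini Nup a b s y) (concConj f ρj) v w T a b t x
  · nlinarith [mul_nonneg (mul_pos hΔ hSbar).le (sq_nonneg (η - 1 / 2))]
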